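/- Under the adapted cuspidal-edge setting, at every point (u₀,0) of the u-axis the v-derivative of the bounded principal curvature satisfies (∂κ/∂v)(u₀,0) = −(1/(2κ_c(u₀)))·(4κ_t(u₀)² + κ_s(u₀)κ_c(u₀)²)·(|(f_u×h)(u₀,0)|/|f_u(u₀,0)|)^{1/2}. -/

import Mathlib

noncomputable section

local notation "⟪" x ", " y "⟫" => @inner ℝ _ _ x y

/-- Euclidean 3-space. -/
abbrev E3 : Type := EuclideanSpace ℝ (Fin 3)

/-- The vector in `E3` with coordinates `(a, b, c)`. -/
def e3 (a b c : ℝ) : E3 := (WithLp.equiv 2 (Fin 3 → ℝ)).symm ![a, b, c]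

/-- Cross product on `E3`. -/
def cross3 (a b : E3) : E3 :=
  e3 (a 1 * b 2 - a 2 * b 1) (a 2 * b 0 - a 0 * b 2) (a 0 * b 1 - a 1 * b 0)

/-- Scalar triple product `det(a,b,c)`. -/
def det3 (a b c : E3) : ℝ := ⟪a, cross3 b c⟫

/-- Partial derivative in the `u`-direction. -/
def pu {E : Type*} [NormedAddCommGroup E] [NormedSpace ℝ E] (g : ℝ × ℝ → E) (p : ℝ × ℝ) : E :=
  fderiv ℝ g p (1, 0)

/-- Partial derivative in the `v`-direction. -/
def pv {E : Type*} [NormedAddCommGroup E] [NormedSpace ℝ E] (g : ℝ × ℝ → E) (p : ℝ × ℝ) : E :=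
  fderiv ℝ g p (0, 1)

/-- Signed area density `λ = det(f_u, f_v, ν)`. -/
def lam (f ν : ℝ × ℝ → E3) (p : ℝ × ℝ) : ℝ := det3 (pu f p) (pv f p) (ν p)


/-- `Ẽ = |f_u|²`. -/
def Etil (f : ℝ × ℝ → E3) (p : ℝ × ℝ) : ℝ := ‖pu f p‖ ^ 2

/-- `F̃ = ⟨f_u, h⟩`. -/
def Ftil (f h : ℝ × ℝ → E3) (p : ℝ × ℝ) : ℝ := ⟪pu f p, h p⟫

/-- `G̃ = |h|²`. -/
def Gtil (h : ℝ × ℝ → E3) (p : ℝ × ℝ) : ℝ := ‖h p‖ ^ 2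

/-- `L̃ = −⟨f_u, ν_u⟩`. -/
def Ltil (f ν : ℝ × ℝ → E3) (p : ℝ × ℝ) : ℝ := -⟪pu f p, pu ν p⟫

/-- `M̃ = −⟨h, ν_u⟩`. -/
def Mtil (ν h : ℝ × ℝ → E3) (p : ℝ × ℝ) : ℝ := -⟪h p, pu ν p⟫

/-- `Ñ = −⟨h, ν_v⟩`. -/
def Ntil (ν h : ℝ × ℝ → E3) (p : ℝ × ℝ) : ℝ := -⟪h p, pv ν p⟫

/-- `Ã = ẼÑ − 2vF̃M̃ + vG̃L̃`. -/
def Atil (f ν h : ℝ × ℝ → E3) (p : ℝ × ℝ) : ℝ :=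
  Etil f p * Ntil ν h p - 2 * p.2 * Ftil f h p * Mtil ν h p + p.2 * Gtil h p * Ltil f ν p

/-- `B̃ = √(Ã² − 4v(ẼG̃−F̃²)(L̃Ñ−vM̃²))`. -/
def Btil (f ν h : ℝ × ℝ → E3) (p : ℝ × ℝ) : ℝ :=
  Real.sqrt ((Atil f ν h p) ^ 2 -
    4 * p.2 * (Etil f p * Gtil h p - (Ftil f h p) ^ 2) *
      (Ltil f ν p * Ntil ν h p - p.2 * (Mtil ν h p) ^ 2))

/-- The bounded principal curvature `κ = 2(L̃Ñ−vM̃²)/(Ã+B̃)`. -/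
def kap (f ν h : ℝ × ℝ → E3) (p : ℝ × ℝ) : ℝ :=
  2 * (Ltil f ν p * Ntil ν h p - p.2 * (Mtil ν h p) ^ 2) / (Atil f ν h p + Btil f ν h p)

/-- `κ̂ = (Ã+B̃)/(2|f_u×h|)`, the smooth extension of `λ·κ₁`. -/
def kaphat (f ν h : ℝ × ℝ → E3) (p : ℝ × ℝ) : ℝ :=
  (Atil f ν h p + Btil f ν h p) / (2 * ‖cross3 (pu f p) (h p)‖)

/-- Singular curvature `κ_s` along the u-axis. -/
def kappas (f ν : ℝ × ℝ → E3) (u : ℝ) : ℝ :=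
  det3 (pu f (u, 0)) (pu (pu f) (u, 0)) (ν (u, 0)) / ‖pu f (u, 0)‖ ^ 3

/-- Cuspidal curvature `κ_c` along the u-axis. -/
def kappac (f ν h : ℝ × ℝ → E3) (u : ℝ) : ℝ :=
  2 * Etil f (u, 0) ^ ((3 : ℝ) / 4) * Ntil ν h (u, 0) /
    (Etil f (u, 0) * Gtil h (u, 0) - (Ftil f h (u, 0)) ^ 2) ^ ((3 : ℝ) / 4)

/-- Cusp-directional torsion `κ_t` along the u-axis. -/
def kappat (f ν h : ℝ × ℝ → E3) (u : ℝ) : ℝ :=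
  (Etil f (u, 0) * Mtil ν h (u, 0) - Ftil f h (u, 0) * Ltil f ν (u, 0)) /
    (Etil f (u, 0) * Real.sqrt (Etil f (u, 0) * Gtil h (u, 0) - (Ftil f h (u, 0)) ^ 2))

/-- The focal surface `ŴFC_f = f + (λ/κ̂)ν`. -/
def FChat (f ν h : ℝ × ℝ → E3) (p : ℝ × ℝ) : E3 :=
  f p + (lam f ν p / kaphat f ν h p) • ν p

/-- Coefficient `E` of the first fundamental form of a surface `W`. -/
def surfE (W : ℝ × ℝ → E3) (p : ℝ × ℝ) : ℝ := ‖pu W p‖ ^ 2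

/-- Coefficient `F` of the first fundamental form of a surface `W`. -/
def surfF (W : ℝ × ℝ → E3) (p : ℝ × ℝ) : ℝ := ⟪pu W p, pv W p⟫

/-- Coefficient `G` of the first fundamental form of a surface `W`. -/
def surfG (W : ℝ × ℝ → E3) (p : ℝ × ℝ) : ℝ := ‖pv W p‖ ^ 2

/-- Unit normal `n = (W_u × W_v)/|W_u × W_v|` of a surface `W`. -/
def surfn (W : ℝ × ℝ → E3) (p : ℝ × ℝ) : E3 :=
  ‖cross3 (pu W p) (pv W p)‖⁻¹ • cross3 (pu W p) (pv W p)

/-- Coefficient `L = ⟨W_uu, n⟩` of the second fundamental form. -/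
def surfL (W : ℝ × ℝ → E3) (p : ℝ × ℝ) : ℝ := ⟪pu (pu W) p, surfn W p⟫

/-- Coefficient `M = ⟨W_uv, n⟩` of the second fundamental form. -/
def surfM (W : ℝ × ℝ → E3) (p : ℝ × ℝ) : ℝ := ⟪pv (pu W) p, surfn W p⟫

/-- Coefficient `N = ⟨W_vv, n⟩` of the second fundamental form. -/
def surfN (W : ℝ × ℝ → E3) (p : ℝ × ℝ) : ℝ := ⟪pv (pv W) p, surfn W p⟫

/-- Gaussian curvature of a surface `W`. -/
def gaussK (W : ℝ × ℝ → E3) (p : ℝ × ℝ) : ℝ :=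
  (surfL W p * surfN W p - (surfM W p) ^ 2) /
    (surfE W p * surfG W p - (surfF W p) ^ 2)

/-- Mean curvature of a surface `W` (w.r.t. the unit normal `surfn W`). -/
def meanH (W : ℝ × ℝ → E3) (p : ℝ × ℝ) : ℝ :=
  (surfE W p * surfN W p - 2 * surfF W p * surfM W p + surfG W p * surfL W p) /
    (2 * (surfE W p * surfG W p - (surfF W p) ^ 2))

theorem pv_eq_of_hasDerivAt {E : Type*} [NormedAddCommGroup E] [NormedSpace ℝ E]
    {g : ℝ × ℝ → E} {u v : ℝ} {g' : E} (hg : DifferentiableAt ℝ g (u, v))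
    (hd : HasDerivAt (fun t => g (u, t)) g' v) : pv g (u, v) = g' := by
  have h1 : HasDerivAt (fun t : ℝ => ((u, t) : ℝ × ℝ)) (0, 1) v :=
    (hasDerivAt_const v u).prodMk (hasDerivAt_id v)
  exact (hg.hasFDerivAt.comp_hasDerivAt v h1).unique hd

theorem hasDerivAt_pv {E : Type*} [NormedAddCommGroup E] [NormedSpace ℝ E]
    {g : ℝ × ℝ → E} {u v : ℝ} (hg : DifferentiableAt ℝ g (u, v)) :
    HasDerivAt (fun t => g (u, t)) (pv g (u, v)) v :=
  hg.hasFDerivAt.comp_hasDerivAt v ((hasDerivAt_const v u).prodMk (hasDerivAt_id v))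

theorem hasDerivAt_pu {E : Type*} [NormedAddCommGroup E] [NormedSpace ℝ E]
    {g : ℝ × ℝ → E} {u v : ℝ} (hg : DifferentiableAt ℝ g (u, v)) :
    HasDerivAt (fun t => g (t, v)) (pu g (u, v)) u :=
  hg.hasFDerivAt.comp_hasDerivAt u ((hasDerivAt_id u).prodMk (hasDerivAt_const u v))

theorem ContDiffOn.pu {E : Type*} [NormedAddCommGroup E] [NormedSpace ℝ E]
    {g : ℝ × ℝ → E} {U : Set (ℝ × ℝ)} (hU : IsOpen U) (hg : ContDiffOn ℝ (⊤ : ℕ∞) g U) :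
    ContDiffOn ℝ (⊤ : ℕ∞) (pu g) U :=
  (hg.fderiv_of_isOpen hU (by simp)).clm_apply contDiffOn_const

theorem ContDiffOn.pv {E : Type*} [NormedAddCommGroup E] [NormedSpace ℝ E]
    {g : ℝ × ℝ → E} {U : Set (ℝ × ℝ)} (hU : IsOpen U) (hg : ContDiffOn ℝ (⊤ : ℕ∞) g U) :
    ContDiffOn ℝ (⊤ : ℕ∞) (pv g) U :=
  (hg.fderiv_of_isOpen hU (by simp)).clm_apply contDiffOn_const

theorem ContDiffOn.differentiableAt_of_mem {E : Type*} [NormedAddCommGroup E] [NormedSpace ℝ E]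
    {g : ℝ × ℝ → E} {U : Set (ℝ × ℝ)} (hU : IsOpen U) (hg : ContDiffOn ℝ (⊤ : ℕ∞) g U)
    {p : ℝ × ℝ} (hp : p ∈ U) : DifferentiableAt ℝ g p :=
  (hg.contDiffAt (hU.mem_nhds hp)).differentiableAt (by simp)

theorem pv_pu_comm {E : Type*} [NormedAddCommGroup E] [NormedSpace ℝ E]
    {g : ℝ × ℝ → E} {U : Set (ℝ × ℝ)} (hU : IsOpen U) (hg : ContDiffOn ℝ (⊤ : ℕ∞) g U)
    {p : ℝ × ℝ} (hp : p ∈ U) : pv (pu g) p = pu (pv g) p := by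
  have hd : DifferentiableAt ℝ (fderiv ℝ g) p :=
    ((hg.fderiv_of_isOpen hU (m := (⊤ : ℕ∞)) (by simp)).contDiffAt
      (hU.mem_nhds hp)).differentiableAt (by simp)
  have hs : IsSymmSndFDerivAt ℝ g p :=
    (hg.contDiffAt (hU.mem_nhds hp)).isSymmSndFDerivAt (by
      simpa using (mod_cast le_top : ((2 : ℕ∞) : WithTop ℕ∞) ≤ ((⊤ : ℕ∞) : WithTop ℕ∞)))
  have key : ∀ x y : ℝ × ℝ, fderiv ℝ (fun q => fderiv ℝ g q x) p y = fderiv ℝ (fderiv ℝ g) p y x := by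
    intro x y
    rw [fderiv_clm_apply hd (differentiableAt_const x)]
    simp
  change fderiv ℝ (fun q => fderiv ℝ g q (1, 0)) p (0, 1) =
    fderiv ℝ (fun q => fderiv ℝ g q (0, 1)) p (1, 0)
  rw [key, key]
  exact hs _ _

theorem inner_e3_coord (x y : E3) : ⟪x, y⟫ = x 0 * y 0 + x 1 * y 1 + x 2 * y 2 := by
  simp [PiLp.inner_apply, Fin.sum_univ_three, mul_comm]

theorem det3_mul_inner (a b c x y : E3) :
    det3 a b c * ⟪x, y⟫ = ⟪x, a⟫ * det3 y b c + ⟪x, b⟫ * det3 a y c + ⟪x, c⟫ * det3 a b y := by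
  simp only [det3, inner_e3_coord, cross3, e3, WithLp.equiv_symm_apply,
    Matrix.cons_val]
  ring

theorem norm_cross3_sq (a b : E3) : ‖cross3 a b‖ ^ 2 = ‖a‖ ^ 2 * ‖b‖ ^ 2 - ⟪a, b⟫ ^ 2 := by
  simp only [← real_inner_self_eq_norm_sq, inner_e3_coord, cross3, e3, WithLp.equiv_symm_apply,
    Matrix.cons_val]
  ring

theorem det3_eq_inner_cross3 (a b c : E3) : det3 a b c = ⟪cross3 a b, c⟫ := by
  simp only [det3, inner_e3_coord, cross3, e3, WithLp.equiv_symm_apply,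
    Matrix.cons_val]
  ring

/-- The derivative at `v = 0` of the bounded root, in terms of one-variable coefficient functions. -/
theorem hasDerivAt_bounded_curvature {E F G L M N : ℝ → ℝ} {E' F' G' L' M' N' : ℝ}
    (hE : HasDerivAt E E' 0) (hF : HasDerivAt F F' 0) (hG : HasDerivAt G G' 0)
    (hL : HasDerivAt L L' 0) (hM : HasDerivAt M M' 0) (hN : HasDerivAt N N' 0)
    (hE0 : 0 < E 0) (hN0 : 0 < N 0) :
    HasDerivAt (fun v => 2 * (L v * N v - v * M v ^ 2) /
      ((E v * N v - 2 * v * F v * M v + v * G v * L v) +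
        Real.sqrt ((E v * N v - 2 * v * F v * M v + v * G v * L v) ^ 2 -
          4 * v * (E v * G v - F v ^ 2) * (L v * N v - v * M v ^ 2))))
      (L' / E 0 - L 0 * E' / E 0 ^ 2 - (E 0 * M 0 - F 0 * L 0) ^ 2 / (E 0 ^ 3 * N 0)) 0 := by
  have hv : HasDerivAt (fun v : ℝ => v) 1 0 := hasDerivAt_id 0
  have hD := (hL.fun_mul hN).fun_sub (hv.fun_mul (hM.fun_pow 2))
  have hA := ((hE.fun_mul hN).fun_sub ((((hv.const_mul 2)).fun_mul hF).fun_mul hM)).fun_add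
    ((hv.fun_mul hG).fun_mul hL)
  have hW := (hE.fun_mul hG).fun_sub (hF.fun_pow 2)
  have hQ := (hA.fun_pow 2).fun_sub (((hv.const_mul 4).fun_mul hW).fun_mul hD)
  have hEN : 0 < E 0 * N 0 := mul_pos hE0 hN0
  have hsq : √((E 0 * N 0) ^ 2) = E 0 * N 0 := Real.sqrt_sq hEN.le
  have hB := hQ.sqrt (by simp [hE0.ne', hN0.ne'])
  have hX := (hD.const_mul 2).fun_div (hA.fun_add hB) (by
    simp [hsq, hE0.ne', hN0.ne'])
  refine hX.congr_deriv ?_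
  simp [hsq]
  field_simp
  ring

theorem curvature_derivative_algebra {e w N T d : ℝ} (he : 0 < e) (hw : 0 < w) (hN : 0 < N) :
    -(N * d / w) / e ^ 2 - T ^ 2 / ((e ^ 2) ^ 3 * N) =
      -(1 / (2 * (2 * (e ^ 2) ^ ((3 : ℝ) / 4) * N / (w ^ 2) ^ ((3 : ℝ) / 4)))) *
        (4 * (T / (e ^ 2 * √(w ^ 2))) ^ 2 +
          d / e ^ 3 * (2 * (e ^ 2) ^ ((3 : ℝ) / 4) * N / (w ^ 2) ^ ((3 : ℝ) / 4)) ^ 2) *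
        √(w / e) := by
  obtain ⟨a, ha, rfl⟩ : ∃ a : ℝ, 0 < a ∧ a ^ 2 = e := ⟨√e, Real.sqrt_pos.2 he, Real.sq_sqrt he.le⟩
  obtain ⟨b, hb, rfl⟩ : ∃ b : ℝ, 0 < b ∧ b ^ 2 = w := ⟨√w, Real.sqrt_pos.2 hw, Real.sq_sqrt hw.le⟩
  have hpow : ∀ x : ℝ, 0 < x → ((x ^ 2) ^ 2) ^ ((3 : ℝ) / 4) = x ^ 3 := by
    intro x hx
    rw [← pow_mul, ← Real.rpow_natCast x (2 * 2), ← Real.rpow_mul hx.le, ← Real.rpow_natCast x 3]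
    norm_num
  rw [hpow a ha, hpow b hb, Real.sqrt_sq (by positivity), ← div_pow, Real.sqrt_sq (by positivity)]
  field_simp
  ring

/-- along the u-axis,
`∂κ/∂v = −(1/(2κ_c))(4κ_t² + κ_sκ_c²)·√(|f_u×h|/|f_u|)`. -/
theorem stmt1
    (U : Set (ℝ × ℝ)) (hU : IsOpen U)
    (f ν h : ℝ × ℝ → E3)
    (hf : ContDiffOn ℝ (⊤ : ℕ∞) f U) (hν : ContDiffOn ℝ (⊤ : ℕ∞) ν U) (hhsm : ContDiffOn ℝ (⊤ : ℕ∞) h U)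
    (hax : ∃ p ∈ U, p.2 = (0 : ℝ))
    (hν1 : ∀ p ∈ U, ‖ν p‖ = 1)
    (ho1 : ∀ p ∈ U, (⟪pu f p, ν p⟫ : ℝ) = 0)
    (ho2 : ∀ p ∈ U, (⟪pv f p, ν p⟫ : ℝ) = 0)
    (hfront : ∀ p ∈ U, Function.Injective ⇑(fderiv ℝ (fun q => (f q, ν q)) p))
    (hlam : ∀ p ∈ U, (lam f ν p = 0 ↔ p.2 = 0))
    (hh0 : ∀ p ∈ U, h p ≠ 0)
    (hfv : ∀ p ∈ U, pv f p = p.2 • h p)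
    (hνdef : ∀ p ∈ U, ν p = ‖cross3 (pu f p) (h p)‖⁻¹ • cross3 (pu f p) (h p))
    (hNpos : ∀ p ∈ U, p.2 = 0 → 0 < Ntil ν h p)
    (u₀ : ℝ) (hp : ((u₀, 0) : ℝ × ℝ) ∈ U) :
    pv (kap f ν h) (u₀, 0) =
      -(1 / (2 * kappac f ν h u₀)) *
        (4 * (kappat f ν h u₀) ^ 2 + kappas f ν u₀ * (kappac f ν h u₀) ^ 2) *
        Real.sqrt (‖cross3 (pu f (u₀, 0)) (h (u₀, 0))‖ / ‖pu f (u₀, 0)‖) := by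
  have hfd := fun {p} (hp : p ∈ U) => hf.differentiableAt_of_mem hU hp
  have hνd := fun {p} (hp : p ∈ U) => hν.differentiableAt_of_mem hU hp
  have hfud := fun {p} (hp : p ∈ U) => (hf.pu hU).differentiableAt_of_mem hU hp
  have hνud := fun {p} (hp : p ∈ U) => (hν.pu hU).differentiableAt_of_mem hU hp
  have hνvd := fun {p} (hp : p ∈ U) => (hν.pv hU).differentiableAt_of_mem hU hp
  have hhd := fun {p} (hp : p ∈ U) => hhsm.differentiableAt_of_mem hU hp
  have hvline : ∀ {u v : ℝ}, (u, v) ∈ U → ∀ᶠ t in nhds v, (u, t) ∈ U := fun {u v} hm =>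
    (by fun_prop : Continuous fun t : ℝ => ((u, t) : ℝ × ℝ)).continuousAt.eventually
      (hU.mem_nhds hm)
  have huline : ∀ {u v : ℝ}, (u, v) ∈ U → ∀ᶠ t in nhds u, (t, v) ∈ U := fun {u v} hm =>
    (by fun_prop : Continuous fun t : ℝ => ((t, v) : ℝ × ℝ)).continuousAt.eventually
      (hU.mem_nhds hm)
  have hfuv : ∀ u : ℝ, (u, (0 : ℝ)) ∈ U → pv (pu f) (u, 0) = 0 := by
    intro u hu
    rw [pv_pu_comm hU hf hu]
    refine (hasDerivAt_pu ((hf.pv hU).differentiableAt_of_mem hU hu)).unique ?_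
    refine (hasDerivAt_const u (0 : E3)).congr_of_eventuallyEq ?_
    filter_upwards [huline hu] with t ht
    simp [hfv _ ht]
  have hfuνv : ∀ u : ℝ, (u, (0 : ℝ)) ∈ U → ⟪pu f (u, 0), pv ν (u, 0)⟫ = 0 := by
    intro u hu
    have h1 := (hasDerivAt_pv (hfud hu)).inner ℝ (hasDerivAt_pv (hνd hu))
    have h2 := h1.unique ((hasDerivAt_const (0 : ℝ) (0 : ℝ)).congr_of_eventuallyEq (by
      filter_upwards [hvline hu] with t ht
      exact ho1 _ ht))
    simpa [hfuv u hu] using h2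
  have hννv : ⟪pv ν (u₀, 0), ν (u₀, 0)⟫ = 0 := by
    have h1 := (hasDerivAt_pv (hνd hp)).inner ℝ (hasDerivAt_pv (hνd hp))
    have h2 := h1.unique ((hasDerivAt_const (0 : ℝ) (1 : ℝ)).congr_of_eventuallyEq (by
      filter_upwards [hvline hp] with t ht
      simp [hν1 _ ht]))
    rw [real_inner_comm] at h2
    linarith
  have hmixed : ⟪pu f (u₀, 0), pv (pu ν) (u₀, 0)⟫ = -⟪pu (pu f) (u₀, 0), pv ν (u₀, 0)⟫ := by
    have h1 := (hasDerivAt_pu (hfud hp)).inner ℝ (hasDerivAt_pu (hνvd hp))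
    have h2 := h1.unique ((hasDerivAt_const u₀ (0 : ℝ)).congr_of_eventuallyEq (by
      filter_upwards [huline hp] with t ht
      exact hfuνv t ht))
    rw [pv_pu_comm hU hν hp]
    linarith
  set w := ‖cross3 (pu f (u₀, 0)) (h (u₀, 0))‖ with hwdef
  have hw : 0 < w := by
    refine (norm_nonneg _).lt_of_ne' fun h0 => ?_
    have h1 := hν1 _ hp
    rw [hνdef _ hp, h0] at h1
    simp at h1
  have hW : w ^ 2 = Etil f (u₀, 0) * Gtil h (u₀, 0) - Ftil f h (u₀, 0) ^ 2 := norm_cross3_sq _ _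
  have he : 0 < ‖pu f (u₀, 0)‖ := by
    refine (norm_nonneg _).lt_of_ne' fun h0 => ?_
    rw [Etil, h0] at hW
    nlinarith [sq_nonneg (Ftil f h (u₀, 0)), pow_pos hw 2]
  have hN := hNpos _ hp rfl
  have hdet : det3 (pu f (u₀, 0)) (h (u₀, 0)) (ν (u₀, 0)) = w := by
    rw [det3_eq_inner_cross3, hνdef _ hp, real_inner_smul_right, real_inner_self_eq_norm_sq,
      ← hwdef]
    field_simp
  have hfuuνv : ⟪pu (pu f) (u₀, 0), pv ν (u₀, 0)⟫ =
      -(Ntil ν h (u₀, 0) * det3 (pu f (u₀, 0)) (pu (pu f) (u₀, 0)) (ν (u₀, 0)) / w) := by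
    have h1 := det3_mul_inner (pu f (u₀, 0)) (h (u₀, 0)) (ν (u₀, 0)) (pv ν (u₀, 0))
      (pu (pu f) (u₀, 0))
    rw [hdet, hννv, real_inner_comm, real_inner_comm (pu f (u₀, 0)), hfuνv _ hp,
      real_inner_comm (h (u₀, 0))] at h1
    rw [Ntil]
    field_simp
    linarith
  have hEd : DifferentiableAt ℝ (Etil f) (u₀, 0) := (hfud hp).norm_sq ℝ
  have hFd : DifferentiableAt ℝ (Ftil f h) (u₀, 0) := (hfud hp).inner ℝ (hhd hp)
  have hGd : DifferentiableAt ℝ (Gtil h) (u₀, 0) := (hhd hp).norm_sq ℝ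
  have hLd : DifferentiableAt ℝ (Ltil f ν) (u₀, 0) := ((hfud hp).inner ℝ (hνud hp)).neg
  have hMd : DifferentiableAt ℝ (Mtil ν h) (u₀, 0) := ((hhd hp).inner ℝ (hνud hp)).neg
  have hNd : DifferentiableAt ℝ (Ntil ν h) (u₀, 0) := ((hhd hp).inner ℝ (hνvd hp)).neg
  have hE0 : 0 < Etil f (u₀, 0) := pow_pos he 2
  have hEv : HasDerivAt (fun t => Etil f (u₀, t)) 0 0 := by
    simpa [hfuv _ hp, Etil] using (hasDerivAt_pv (hfud hp)).norm_sq
  have hLv : HasDerivAt (fun t => Ltil f ν (u₀, t)) ⟪pu (pu f) (u₀, 0), pv ν (u₀, 0)⟫ 0 := by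
    refine (((hasDerivAt_pv (hfud hp)).inner ℝ (hasDerivAt_pv (hνud hp))).fun_neg).congr_deriv ?_
    simp [hfuv _ hp, hmixed]
  have hA0 : Atil f ν h (u₀, 0) = Etil f (u₀, 0) * Ntil ν h (u₀, 0) := by simp [Atil]
  have hA0pos : 0 < Atil f ν h (u₀, 0) := hA0 ▸ mul_pos hE0 hN
  have hkd : DifferentiableAt ℝ (kap f ν h) (u₀, 0) := by
    have hAd : DifferentiableAt ℝ (Atil f ν h) (u₀, 0) := by
      unfold Atil
      fun_prop
    have hBd : DifferentiableAt ℝ (Btil f ν h) (u₀, 0) := by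
      unfold Btil
      refine DifferentiableAt.sqrt (by fun_prop) ?_
      simp [hA0pos.ne']
    have hne : Atil f ν h (u₀, 0) + Btil f ν h (u₀, 0) ≠ 0 :=
      (add_pos_of_pos_of_nonneg hA0pos (Real.sqrt_nonneg _)).ne'
    unfold kap
    fun_prop (disch := assumption)
  rw [pv_eq_of_hasDerivAt hkd (hasDerivAt_bounded_curvature hEv (hasDerivAt_pv hFd)
    (hasDerivAt_pv hGd) hLv (hasDerivAt_pv hMd) (hasDerivAt_pv hNd) hE0 hN), hfuuνv]
  rw [kappac, kappat, kappas, ← hW, mul_zero, zero_div, sub_zero]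
  exact curvature_derivative_algebra he hw hN
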